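/- arXiv:2503.16098 — 2 statements merged into one kernel-verified Lean document; each statement's English description precedes it below -/
import Mathlib

section
/- Let Y1, Y0, X be compact metric spaces with Borel σ-algebras, μ1X and μ0X Borel probability measures on Y1 × X and Y0 × X with the same X-marginal, m1 : Y0 × X → (k × d_θ real matrices) continuous, and m2 : Y1 × Y0 × X → ℝ^k continuous. For θ ∈ ℝ^{d_θ}, the following are equivalent: (a) there exists μ ∈ M(μ1X, μ0X) with ∫ (m1(y0, x) θ + m2(y1, y0, x)) dμ = 0; (b) for every t in the unit sphere of ℝ^k, tᵀ (∫ m1 dμ0X) θ ≤ − inf over μ ∈ M(μ1X, μ0X) of ∫ ⟨t, m2(y1, y0, x)⟩ dμ. (Theorem 2(i): the rewriting of the identified set for affine moment functions.) -/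
open MeasureTheory
open scoped RealInnerProductSpace

/-- The set `M(μ1X, μ0X)` of probability measures on `Y1 × Y0 × X` whose projection on
`(Y1, X)` is `μ1X` and whose projection on `(Y0, X)` is `μ0X`. -/
def MSet {Y1 Y0 X : Type*} [MeasurableSpace Y1] [MeasurableSpace Y0] [MeasurableSpace X]
    (μ1X : Measure (Y1 × X)) (μ0X : Measure (Y0 × X)) :
    Set (Measure (Y1 × Y0 × X)) :=
  {μ | IsProbabilityMeasure μ ∧
    μ.map (fun p => (p.1, p.2.2)) = μ1X ∧ μ.map (fun p => (p.2.1, p.2.2)) = μ0X}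

section
open ProbabilityTheory

theorem MSet_nonempty_aux
    {Y1 Y0 X : Type*}
    [MetricSpace Y1] [CompactSpace Y1] [MeasurableSpace Y1] [BorelSpace Y1]
    [MetricSpace Y0] [CompactSpace Y0] [MeasurableSpace Y0] [BorelSpace Y0]
    [MeasurableSpace X]
    (μ1X : Measure (Y1 × X)) (μ0X : Measure (Y0 × X))
    [IsProbabilityMeasure μ1X] [IsProbabilityMeasure μ0X]
    (hmarg : μ1X.map Prod.snd = μ0X.map Prod.snd) : (MSet μ1X μ0X).Nonempty := by
  haveI : Nonempty Y1 := (nonempty_of_isProbabilityMeasure μ1X).map Prod.fst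
  haveI : Nonempty Y0 := (nonempty_of_isProbabilityMeasure μ0X).map Prod.fst
  set ρ1 : Measure (X × Y1) := μ1X.map Prod.swap with hρ1
  set ρ0 : Measure (X × Y0) := μ0X.map Prod.swap with hρ0
  haveI : IsProbabilityMeasure ρ1 := Measure.isProbabilityMeasure_map measurable_swap.aemeasurable
  haveI : IsProbabilityMeasure ρ0 := Measure.isProbabilityMeasure_map measurable_swap.aemeasurable
  have hf : ρ1.fst = ρ0.fst := by
    rw [Measure.fst, Measure.fst, hρ1, hρ0, Measure.map_map measurable_fst measurable_swap,
      Measure.map_map measurable_fst measurable_swap]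
    exact hmarg
  set κ1 := ρ1.condKernel
  set κ0 := ρ0.condKernel
  have d1 : ρ1.fst ⊗ₘ κ1 = ρ1 := ρ1.disintegrate κ1
  have d0 : ρ1.fst ⊗ₘ κ0 = ρ0 := by rw [hf]; exact ρ0.disintegrate κ0
  set P : Measure (X × (Y1 × Y0)) := ρ1.fst ⊗ₘ (κ1.prod κ0) with hP
  have e1 : P.map (Prod.map id Prod.fst) = ρ1 := by
    rw [hP, ← Measure.compProd_map measurable_fst, ← Kernel.fst_eq, Kernel.fst_prod, d1]
  have e0 : P.map (Prod.map id Prod.snd) = ρ0 := by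
    rw [hP, ← Measure.compProd_map measurable_snd, ← Kernel.snd_eq, Kernel.snd_prod, d0]
  have hm : Measurable (fun q : X × (Y1 × Y0) => (q.2.1, q.2.2, q.1)) := by fun_prop
  refine ⟨P.map (fun q => (q.2.1, q.2.2, q.1)), Measure.isProbabilityMeasure_map hm.aemeasurable,
    ?_, ?_⟩
  · rw [Measure.map_map (by fun_prop) hm]
    have : μ1X = ρ1.map Prod.swap := by
      rw [hρ1, Measure.map_map measurable_swap measurable_swap]; simp
    rw [this, ← e1, Measure.map_map measurable_swap (by fun_prop)]
    rfl
  · rw [Measure.map_map (by fun_prop) hm]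
    have : μ0X = ρ0.map Prod.swap := by
      rw [hρ0, Measure.map_map measurable_swap measurable_swap]; simp
    rw [this, ← e0, Measure.map_map measurable_swap (by fun_prop)]
    rfl

theorem integrable_aux {Ω E : Type*} [MetricSpace Ω] [CompactSpace Ω] [MeasurableSpace Ω]
    [BorelSpace Ω] [NormedAddCommGroup E]
    (μ : Measure Ω) [IsFiniteMeasure μ] {f : Ω → E} (hf : Continuous f) : Integrable f μ := by
  rw [← integrableOn_univ]
  exact hf.continuousOn.integrableOn_compact isCompact_univ

theorem continuous_integral_aux {Ω : Type*} [MetricSpace Ω] [CompactSpace Ω] [MeasurableSpace Ω]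
    [BorelSpace Ω] {k : ℕ} (g : Ω → EuclideanSpace ℝ (Fin k)) (hg : Continuous g) :
    Continuous (fun μ : ProbabilityMeasure Ω => ∫ p, g p ∂(μ : Measure Ω)) := by
  rw [(EuclideanSpace.equiv (Fin k) ℝ).toHomeomorph.isInducing.continuous_iff]
  refine continuous_pi fun i => ?_
  have hgi : Continuous (fun p => g p i) := by fun_prop
  have h : ∀ μ : ProbabilityMeasure Ω, (∫ p, g p ∂(μ : Measure Ω)) i
      = ∫ p, g p i ∂(μ : Measure Ω) := fun μ =>
    ((EuclideanSpace.proj (𝕜 := ℝ) i).integral_comp_comm (integrable_aux _ hg)).symm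
  change Continuous (fun μ : ProbabilityMeasure Ω => (∫ p, g p ∂(μ : Measure Ω)) i)
  simp_rw [h]
  rw [continuous_iff_continuousAt]
  intro μ
  exact ProbabilityMeasure.tendsto_iff_forall_integral_tendsto.1 Filter.tendsto_id
    (BoundedContinuousFunction.mkOfCompact ⟨_, hgi⟩)

theorem compact_aux
    {Y1 Y0 X : Type*}
    [MetricSpace Y1] [CompactSpace Y1] [MeasurableSpace Y1] [BorelSpace Y1]
    [MetricSpace Y0] [CompactSpace Y0] [MeasurableSpace Y0] [BorelSpace Y0]
    [MetricSpace X] [CompactSpace X] [MeasurableSpace X] [BorelSpace X]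
    (μ1X : Measure (Y1 × X)) (μ0X : Measure (Y0 × X))
    [IsProbabilityMeasure μ1X] [IsProbabilityMeasure μ0X]
    {k : ℕ} (g : Y1 × Y0 × X → EuclideanSpace ℝ (Fin k)) (hg : Continuous g) :
    IsCompact {c | ∃ μ ∈ MSet μ1X μ0X, c = ∫ p, g p ∂μ} := by
  have c1 : Continuous (fun p : Y1 × Y0 × X => (p.1, p.2.2)) := by fun_prop
  have c0 : Continuous (fun p : Y1 × Y0 × X => (p.2.1, p.2.2)) := by fun_prop
  have hcl : IsClosed {μ : ProbabilityMeasure (Y1 × Y0 × X) |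
      μ.map c1.aemeasurable = ⟨μ1X, inferInstance⟩ ∧
      μ.map c0.aemeasurable = ⟨μ0X, inferInstance⟩} :=
    (isClosed_eq (ProbabilityMeasure.continuous_map c1) continuous_const).inter
      (isClosed_eq (ProbabilityMeasure.continuous_map c0) continuous_const)
  convert hcl.isCompact.image (continuous_integral_aux g hg) using 1
  ext c
  constructor
  · rintro ⟨μ, ⟨h, h1, h0⟩, rfl⟩
    exact ⟨⟨μ, h⟩, ⟨Subtype.ext h1, Subtype.ext h0⟩, rfl⟩
  · rintro ⟨μ, ⟨h1, h0⟩, rfl⟩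
    exact ⟨μ, ⟨inferInstance, congrArg Subtype.val h1, congrArg Subtype.val h0⟩, rfl⟩

theorem convex_aux
    {Y1 Y0 X : Type*}
    [MetricSpace Y1] [CompactSpace Y1] [MeasurableSpace Y1] [BorelSpace Y1]
    [MetricSpace Y0] [CompactSpace Y0] [MeasurableSpace Y0] [BorelSpace Y0]
    [MetricSpace X] [CompactSpace X] [MeasurableSpace X] [BorelSpace X]
    (μ1X : Measure (Y1 × X)) (μ0X : Measure (Y0 × X))
    {k : ℕ} (g : Y1 × Y0 × X → EuclideanSpace ℝ (Fin k)) (hg : Continuous g) :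
    Convex ℝ {c | ∃ μ ∈ MSet μ1X μ0X, c = ∫ p, g p ∂μ} := by
  rintro _ ⟨μ, ⟨hμ, h1, h0⟩, rfl⟩ _ ⟨ν, ⟨hν, j1, j0⟩, rfl⟩ a b ha hb hab
  have hE : ENNReal.ofReal a + ENNReal.ofReal b = 1 := by
    rw [← ENNReal.ofReal_add ha hb, hab, ENNReal.ofReal_one]
  refine ⟨ENNReal.ofReal a • μ + ENNReal.ofReal b • ν, ⟨⟨by simp [hE]⟩, ?_, ?_⟩, ?_⟩
  · rw [Measure.map_add _ _ (by fun_prop), Measure.map_smul, Measure.map_smul, h1, j1,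
      ← add_smul, hE, one_smul]
  · rw [Measure.map_add _ _ (by fun_prop), Measure.map_smul, Measure.map_smul, h0, j0,
      ← add_smul, hE, one_smul]
  · rw [integral_add_measure ((integrable_aux μ hg).smul_measure ENNReal.ofReal_ne_top)
      ((integrable_aux ν hg).smul_measure ENNReal.ofReal_ne_top),
      integral_smul_measure, integral_smul_measure, ENNReal.toReal_ofReal ha,
      ENNReal.toReal_ofReal hb]

end

/-- Theorem 2(i): for affine moment functions `m(y1,y0,x;θ) = m1(y0,x) θ + m2(y1,y0,x)`
(with `m1` a continuous `k × d_θ` matrix-valued function, viewed as linear maps),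
the moment condition holds for some `μ ∈ M(μ1X, μ0X)` iff for every `t` on the unit sphere,
`tᵀ (∫ m1 dμ0X) θ ≤ − inf_{μ ∈ M(μ1X,μ0X)} ∫ ⟨t, m2⟩ dμ`. -/
theorem affine_moment_identified_set_characterization
    {Y1 Y0 X : Type*}
    [MetricSpace Y1] [CompactSpace Y1] [MeasurableSpace Y1] [BorelSpace Y1]
    [MetricSpace Y0] [CompactSpace Y0] [MeasurableSpace Y0] [BorelSpace Y0]
    [MetricSpace X] [CompactSpace X] [MeasurableSpace X] [BorelSpace X]
    (μ1X : Measure (Y1 × X)) (μ0X : Measure (Y0 × X))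
    [IsProbabilityMeasure μ1X] [IsProbabilityMeasure μ0X]
    (hmarg : μ1X.map Prod.snd = μ0X.map Prod.snd)
    {k dθ : ℕ}
    (m1 : Y0 × X → (EuclideanSpace ℝ (Fin dθ) →L[ℝ] EuclideanSpace ℝ (Fin k)))
    (hm1 : Continuous m1)
    (m2 : Y1 × Y0 × X → EuclideanSpace ℝ (Fin k)) (hm2 : Continuous m2)
    (θ : EuclideanSpace ℝ (Fin dθ)) :
    (∃ μ ∈ MSet μ1X μ0X, ∫ p, (m1 (p.2.1, p.2.2)) θ + m2 p ∂μ = 0) ↔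
      ∀ t : EuclideanSpace ℝ (Fin k), ‖t‖ = 1 →
        ⟪t, (∫ q, m1 q ∂μ0X) θ⟫ ≤
          - sInf {r : ℝ | ∃ μ ∈ MSet μ1X μ0X, r = ∫ p, ⟪t, m2 p⟫ ∂μ} := by
  have hg1 : Continuous (fun p : Y1 × Y0 × X => (m1 (p.2.1, p.2.2)) θ) := by fun_prop
  have hg : Continuous (fun p : Y1 × Y0 × X => (m1 (p.2.1, p.2.2)) θ + m2 p) := hg1.add hm2
  have key : ∀ μ ∈ MSet μ1X μ0X, ∫ p, (m1 (p.2.1, p.2.2)) θ + m2 p ∂μ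
      = (∫ q, m1 q ∂μ0X) θ + ∫ p, m2 p ∂μ := by
    rintro μ ⟨hμ, h1, h0⟩
    rw [integral_add (integrable_aux μ hg1) (integrable_aux μ hm2),
      ContinuousLinearMap.integral_apply (integrable_aux μ0X hm1), ← h0,
      integral_map (by fun_prop)
        (by fun_prop : Continuous fun q => m1 q θ).aestronglyMeasurable]
  have hin : ∀ t, ∀ μ ∈ MSet μ1X μ0X, ∫ p, ⟪t, m2 p⟫ ∂μ = ⟪t, ∫ p, m2 p ∂μ⟫ := by
    rintro t μ ⟨hμ, h1, h0⟩
    exact integral_inner (integrable_aux μ hm2) t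
  constructor
  · rintro ⟨μ, hμ, h⟩ t ht
    rw [key μ hμ] at h
    have hb : BddBelow {r : ℝ | ∃ μ ∈ MSet μ1X μ0X, r = ∫ p, ⟪t, m2 p⟫ ∂μ} := by
      have hc := ((compact_aux μ1X μ0X m2 hm2).image
        (by fun_prop : Continuous fun c : EuclideanSpace ℝ (Fin k) => ⟪t, c⟫)).bddBelow
      refine hc.mono ?_
      rintro _ ⟨ν, hν, rfl⟩
      exact ⟨_, ⟨ν, hν, rfl⟩, (hin t ν hν).symm⟩
    have := csInf_le hb ⟨μ, hμ, rfl⟩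
    rw [hin t μ hμ] at this
    have h2 : ⟪t, (∫ q, m1 q ∂μ0X) θ⟫ + ⟪t, ∫ p, m2 p ∂μ⟫ = 0 := by
      rw [← inner_add_right, h, inner_zero_right]
    linarith
  · intro H
    by_contra hno
    have hC : (0 : EuclideanSpace ℝ (Fin k)) ∉ {c | ∃ μ ∈ MSet μ1X μ0X,
        c = ∫ p, (m1 (p.2.1, p.2.2)) θ + m2 p ∂μ} := by
      rintro ⟨μ, hμ, h⟩
      exact hno ⟨μ, hμ, h.symm⟩
    obtain ⟨f, u, hu, hf⟩ := geometric_hahn_banach_point_closed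
      (convex_aux μ1X μ0X _ hg) (compact_aux μ1X μ0X _ hg).isClosed hC
    rw [map_zero] at hu
    obtain ⟨s, rfl⟩ := (InnerProductSpace.toDual ℝ (EuclideanSpace ℝ (Fin k))).surjective f
    simp only [InnerProductSpace.toDual_apply_apply] at hf
    obtain ⟨μ, hμ⟩ := MSet_nonempty_aux μ1X μ0X hmarg
    have hs : s ≠ 0 := by
      rintro rfl
      have := hf _ ⟨μ, hμ, rfl⟩
      rw [inner_zero_left] at this
      linarith
    have hs' : 0 < ‖s‖ := norm_pos_iff.2 hs
    have hH := H (‖s‖⁻¹ • s) (by rw [norm_smul, norm_inv, norm_norm, inv_mul_cancel₀ hs'.ne'])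
    have hle : ‖s‖⁻¹ * u - ⟪‖s‖⁻¹ • s, (∫ q, m1 q ∂μ0X) θ⟫ ≤
        sInf {r : ℝ | ∃ μ ∈ MSet μ1X μ0X, r = ∫ p, ⟪‖s‖⁻¹ • s, m2 p⟫ ∂μ} := by
      refine le_csInf ⟨_, μ, hμ, rfl⟩ ?_
      rintro _ ⟨ν, hν, rfl⟩
      have h3 := hf _ ⟨ν, hν, rfl⟩
      rw [key ν hν, inner_add_right] at h3
      rw [hin _ ν hν, real_inner_smul_left, real_inner_smul_left]
      have := mul_le_mul_of_nonneg_left h3.le (inv_pos.2 hs').le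
      linarith
    have : 0 < ‖s‖⁻¹ * u := mul_pos (inv_pos.2 hs') hu
    linarith
end

section
/- Consider the linear projection model with univariate outcome Y1 ∈ ℝ, regressors Y0 ∈ ℝ^{d_0} and X ∈ ℝ^{d_x}. Let μ1X and μ0X be compactly supported Borel probability measures on ℝ × ℝ^{d_x} and ℝ^{d_0} × ℝ^{d_x} with the same X-marginal μ_X, and let κ1 (a kernel from ℝ^{d_x} to probability measures on ℝ) and κ0 (a kernel from ℝ^{d_x} to probability measures on ℝ^{d_0}) be disintegrations of μ1X and μ0X with respect to μ_X. Let M := ∫ (y0, x)(y0, x)ᵀ dμ0X ∈ ℝ^{(d_0+d_x)×(d_0+d_x)}. Then for θ ∈ ℝ^{d_0+d_x}, there exists μ ∈ M(μ1X, μ0X) with ∫ ((y0ᵀ, xᵀ)θ − y1)·(y0, x) dμ = 0 if and only if for every t = (t0, tX) in the unit sphere of ℝ^{d_0+d_x}: tᵀ M θ ≤ ∫_{ℝ^{d_x}} ∫₀¹ F⁻¹_{ν(x,t0)}(u) · F⁻¹_{κ1(x)}(u) du dμ_X(x) + tXᵀ ∫ y1·x dμ1X(y1, x), where ν(x, t0)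 is the pushforward of κ0(x) under y0 ↦ ⟨t0, y0⟩ (Proposition 4: the identified set of the linear projection model for Y0 of arbitrary dimension). -/
open MeasureTheory ProbabilityTheory
open scoped RealInnerProductSpace

/-- The quantile function of a probability measure `ν` on `ℝ`:
`F_ν⁻¹(u) = inf {y : F_ν(y) ≥ u}` where `F_ν(y) = ν((-∞, y])`. -/
noncomputable def quantile (ν : Measure ℝ) (u : ℝ) : ℝ :=
  sInf {y : ℝ | u ≤ (ν (Set.Iic y)).toReal}

section helpers
open Set


lemma quantile_le_iff (ν : Measure ℝ) [IsProbabilityMeasure ν] {u : ℝ} (hu : u ∈ Ioo (0:ℝ) 1)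
    (y : ℝ) : quantile ν u ≤ y ↔ u ≤ (ν (Iic y)).toReal := by
  have hF : ∀ y, (ν (Iic y)).toReal = cdf ν y := fun y => (cdf_eq_real ν y).symm
  unfold quantile
  simp only [hF]
  have hbdd : BddBelow {y : ℝ | u ≤ cdf ν y} := by
    have := (tendsto_cdf_atBot ν).eventually (gt_mem_nhds hu.1)
    obtain ⟨b, hb⟩ := this.exists
    refine ⟨b, fun z hz => ?_⟩
    by_contra hlt
    push Not at hlt
    have := monotone_cdf ν hlt.le
    simp only [mem_ofPred_eq] at hz
    linarith
  have hne : {y : ℝ | u ≤ cdf ν y}.Nonempty := by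
    have := (tendsto_cdf_atTop ν).eventually (lt_mem_nhds hu.2)
    obtain ⟨b, hb⟩ := this.exists
    exact ⟨b, hb.le⟩
  constructor
  · intro h
    have hr : Filter.Tendsto (cdf ν) (nhdsWithin y (Ioi y)) (nhds (cdf ν y)) :=
      ((cdf ν).right_continuous y).tendsto.mono_left (nhdsWithin_mono _ Ioi_subset_Ici_self)
    refine ge_of_tendsto hr ?_
    filter_upwards [self_mem_nhdsWithin] with z hz
    obtain ⟨w, hw, hwz⟩ := exists_lt_of_csInf_lt hne (lt_of_le_of_lt h hz)
    exact le_trans hw (monotone_cdf ν hwz.le)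
  · intro h
    exact csInf_le hbdd h

noncomputable def unifM : Measure ℝ := volume.restrict (Ioo (0:ℝ) 1)

instance : IsProbabilityMeasure unifM := ⟨by simp [unifM]⟩

variable {X : Type*} [MeasurableSpace X]

open Classical in
noncomputable def qfun (κ : Kernel X ℝ) (p : X × ℝ) : ℝ :=
  if p.2 ∈ Ioo (0:ℝ) 1 then quantile (κ p.1) p.2 else 0

lemma measurable_qfun (κ : Kernel X ℝ) [IsMarkovKernel κ] : Measurable (qfun κ) := by
  refine measurable_of_Iic fun y => ?_
  have h1 : MeasurableSet {p : X × ℝ | p.2 ∈ Ioo (0:ℝ) 1} := measurable_snd measurableSet_Ioo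
  have h2 : MeasurableSet {p : X × ℝ | p.2 ≤ (κ p.1 (Iic y)).toReal} :=
    measurableSet_le measurable_snd
      ((κ.measurable_coe measurableSet_Iic).comp measurable_fst).ennreal_toReal
  have : qfun κ ⁻¹' Iic y = ({p : X × ℝ | p.2 ∈ Ioo (0:ℝ) 1} ∩
      {p : X × ℝ | p.2 ≤ (κ p.1 (Iic y)).toReal}) ∪
      ({p : X × ℝ | p.2 ∈ Ioo (0:ℝ) 1}ᶜ ∩ {p : X × ℝ | 0 ≤ y}) := by
    ext p
    by_cases hp : p.2 ∈ Ioo (0:ℝ) 1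
    · have := quantile_le_iff (κ p.1) hp y
      simp only [qfun, mem_preimage, hp, if_true, mem_Iic, mem_union, mem_inter_iff, mem_ofPred_eq,
        mem_compl_iff, true_and, not_true, false_and, or_false]
      exact this
    · simp only [qfun, mem_preimage, hp, if_false, mem_Iic, mem_union, mem_inter_iff, mem_ofPred_eq,
        mem_compl_iff, true_and, not_false_eq_true, false_and, false_or]
  rw [this]
  exact (h1.inter h2).union (h1.compl.inter (MeasurableSet.const _))

lemma unif_Ioi {c : ℝ} (h0 : 0 ≤ c) (h1 : c ≤ 1) :
    unifM (Ioi c) = ENNReal.ofReal (1 - c) := by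
  rw [unifM, Measure.restrict_apply measurableSet_Ioi]
  have : Ioi c ∩ Ioo 0 1 = Ioo c 1 := by
    ext z; simp only [mem_inter_iff, mem_Ioi, mem_Ioo]
    constructor
    · rintro ⟨a, b, c⟩; exact ⟨a, c⟩
    · rintro ⟨a, b⟩; exact ⟨a, by linarith, b⟩
  rw [this, Real.volume_Ioo]

lemma ae_unif : ∀ᵐ u ∂unifM, u ∈ Ioo (0:ℝ) 1 := ae_restrict_mem measurableSet_Ioo

lemma lt_qfun_iff (κ : Kernel X ℝ) [IsMarkovKernel κ] (x : X) {u : ℝ} (hu : u ∈ Ioo (0:ℝ) 1)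
    (s : ℝ) : s < qfun κ (x, u) ↔ (κ x (Iic s)).toReal < u := by
  have := quantile_le_iff (κ x) hu s
  simp only [qfun, hu, if_true]
  rw [← not_le, this, not_le]

lemma tail_eq (ν : Measure ℝ) [IsProbabilityMeasure ν] (s : ℝ) :
    ν (Ioi s) = ENNReal.ofReal (1 - (ν (Iic s)).toReal) := by
  rw [← compl_Iic, prob_compl_eq_one_sub measurableSet_Iic, ENNReal.ofReal_sub _ (by positivity)]
  simp

lemma toReal_prob_le (ν : Measure ℝ) [IsProbabilityMeasure ν] (A : Set ℝ) :
    (ν A).toReal ≤ 1 := ENNReal.toReal_le_of_le_ofReal zero_le_one (by simpa using prob_le_one)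

lemma unif_tail (κ : Kernel X ℝ) [IsMarkovKernel κ] (x : X) (s : ℝ) :
    unifM {u | s < qfun κ (x, u)} = κ x (Ioi s) := by
  have : unifM {u | s < qfun κ (x, u)} = unifM (Ioi (κ x (Iic s)).toReal) := by
    apply measure_congr
    filter_upwards [ae_unif] with u hu
    exact propext (lt_qfun_iff κ x hu s)
  rw [this, unif_Ioi ENNReal.toReal_nonneg (toReal_prob_le _ _), tail_eq]

lemma unif_tail2 (κ η : Kernel X ℝ) [IsMarkovKernel κ] [IsMarkovKernel η] (x : X) (s t : ℝ) :
    unifM {u | s < qfun κ (x, u) ∧ t < qfun η (x, u)} = min (κ x (Ioi s)) (η x (Ioi t)) := by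
  have : unifM {u | s < qfun κ (x, u) ∧ t < qfun η (x, u)} =
      unifM (Ioi (max (κ x (Iic s)).toReal (η x (Iic t)).toReal)) := by
    apply measure_congr
    filter_upwards [ae_unif] with u hu
    refine propext ?_
    have h1 := lt_qfun_iff κ x hu s
    have h2 := lt_qfun_iff η x hu t
    change (_ ∧ _) ↔ max _ _ < u
    rw [h1, h2, max_lt_iff]
  rw [this, unif_Ioi (le_max_of_le_left ENNReal.toReal_nonneg)
    (max_le (toReal_prob_le _ _) (toReal_prob_le _ _)), tail_eq, tail_eq]
  rw [← ENNReal.ofReal_mono.map_min]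
  congr 1
  exact (min_sub_sub_left _ _ _).symm

lemma map_qfun_slice (κ : Kernel X ℝ) [IsMarkovKernel κ] (x : X) :
    unifM.map (fun u => qfun κ (x, u)) = κ x := by
  have hm : Measurable (fun u => qfun κ (x, u)) := (measurable_qfun κ).comp measurable_prodMk_left
  have : IsProbabilityMeasure (unifM.map (fun u => qfun κ (x, u))) :=
    Measure.isProbabilityMeasure_map hm.aemeasurable
  refine Measure.ext_of_Iic _ _ fun s => ?_
  rw [← compl_Ioi, prob_compl_eq_one_sub measurableSet_Ioi, prob_compl_eq_one_sub measurableSet_Ioi,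
    Measure.map_apply hm measurableSet_Ioi]
  exact congrArg (fun c => 1 - c) (unif_tail κ x s)

lemma map_qfun (μ : Measure X) [IsProbabilityMeasure μ] (κ : Kernel X ℝ) [IsMarkovKernel κ] :
    (μ.prod unifM).map (fun p => (p.1, qfun κ p)) = μ ⊗ₘ κ := by
  have hm : Measurable (fun p : X × ℝ => (p.1, qfun κ p)) :=
    measurable_fst.prodMk (measurable_qfun κ)
  ext s hs
  rw [Measure.map_apply hm hs, Measure.prod_apply (hm hs), Measure.compProd_apply hs]
  refine lintegral_congr fun x => ?_
  have hm2 : Measurable (fun u => qfun κ (x, u)) := (measurable_qfun κ).comp measurable_prodMk_left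
  rw [← map_qfun_slice κ x, Measure.map_apply hm2 (measurable_prodMk_left hs)]
  rfl

lemma measurableSet_and_lt {Ω : Type*} [MeasurableSpace Ω] {a b c d : Ω → ℝ} (ha : Measurable a)
    (hb : Measurable b) (hc : Measurable c) (hd : Measurable d) :
    MeasurableSet {ω | a ω < b ω ∧ c ω < d ω} := by
  have h1 := measurableSet_lt ha hb
  have h2 := measurableSet_lt hc hd
  exact h1.inter h2

lemma prod_tail (μ : Measure X) [IsProbabilityMeasure μ] (κ η : Kernel X ℝ) [IsMarkovKernel κ]
    [IsMarkovKernel η] (s t : ℝ) :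
    (μ.prod unifM) {p | s < qfun κ p ∧ t < qfun η p} =
      ∫⁻ x, min (κ x (Ioi s)) (η x (Ioi t)) ∂μ := by
  have hS : MeasurableSet {p : X × ℝ | s < qfun κ p ∧ t < qfun η p} :=
    measurableSet_and_lt measurable_const (measurable_qfun κ) measurable_const (measurable_qfun η)
  rw [Measure.prod_apply hS]
  exact lintegral_congr fun x => unif_tail2 κ η x s t

lemma coupling_tail {Ω : Type*} [MeasurableSpace Ω] (P : Measure Ω)
    (μ : Measure X) [IsProbabilityMeasure μ] (κ η : Kernel X ℝ) [IsMarkovKernel κ]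
    [IsMarkovKernel η] (x : Ω → X) (A B : Ω → ℝ) (hx : Measurable x) (hA : Measurable A)
    (hB : Measurable B) (h1 : P.map (fun ω => (x ω, A ω)) = μ ⊗ₘ κ)
    (h2 : P.map (fun ω => (x ω, B ω)) = μ ⊗ₘ η) (s t : ℝ) :
    P {ω | s < A ω ∧ t < B ω} ≤ ∫⁻ x, min (κ x (Ioi s)) (η x (Ioi t)) ∂μ := by
  have hκ : Measurable fun x => κ x (Ioi s) := κ.measurable_coe measurableSet_Ioi
  have hη : Measurable fun x => η x (Ioi t) := η.measurable_coe measurableSet_Ioi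
  set C : Set X := {x | κ x (Ioi s) ≤ η x (Ioi t)} with hCdef
  have hC : MeasurableSet C := measurableSet_le hκ hη
  have e1 : P {ω | x ω ∈ C ∧ s < A ω} = ∫⁻ x in C, κ x (Ioi s) ∂μ := by
    rw [← Measure.compProd_apply_prod hC measurableSet_Ioi, ← h1,
      Measure.map_apply (hx.prodMk hA) (hC.prod measurableSet_Ioi)]
    rfl
  have e2 : P {ω | x ω ∈ Cᶜ ∧ t < B ω} = ∫⁻ x in Cᶜ, η x (Ioi t) ∂μ := by
    rw [← Measure.compProd_apply_prod hC.compl measurableSet_Ioi, ← h2,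
      Measure.map_apply (hx.prodMk hB) (hC.compl.prod measurableSet_Ioi)]
    rfl
  calc P {ω | s < A ω ∧ t < B ω} ≤ P ({ω | x ω ∈ C ∧ s < A ω} ∪ {ω | x ω ∈ Cᶜ ∧ t < B ω}) := by
        apply measure_mono
        rintro ω ⟨ha, hb⟩
        by_cases h : x ω ∈ C
        · exact Or.inl ⟨h, ha⟩
        · exact Or.inr ⟨h, hb⟩
    _ ≤ _ := measure_union_le _ _
    _ = ∫⁻ x, min (κ x (Ioi s)) (η x (Ioi t)) ∂μ := by
        rw [e1, e2, ← lintegral_add_compl (fun x => min (κ x (Ioi s)) (η x (Ioi t))) hC]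
        congr 1
        · refine setLIntegral_congr_fun hC fun x hx => ?_
          exact (min_eq_left hx).symm
        · refine setLIntegral_congr_fun hC.compl fun x hx => ?_
          exact (min_eq_right (le_of_lt (lt_of_not_ge fun h => hx h))).symm

lemma ofReal_layer (R a : ℝ) :
    ENNReal.ofReal (a + R) = ∫⁻ s in Ioi (-R), (Iio a).indicator 1 s := by
  rw [lintegral_indicator_one measurableSet_Iio, Measure.restrict_apply measurableSet_Iio,
    inter_comm, Ioi_inter_Iio, Real.volume_Ioo]
  congr 1; ring

lemma layer2 {Ω : Type*} [MeasurableSpace Ω] (P : Measure Ω) [IsProbabilityMeasure P] (R : ℝ)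
    (A B : Ω → ℝ) (hA : Measurable A) (hB : Measurable B) :
    ∫⁻ ω, ENNReal.ofReal (A ω + R) * ENNReal.ofReal (B ω + R) ∂P =
      ∫⁻ s in Ioi (-R), ∫⁻ t in Ioi (-R), P {ω | s < A ω ∧ t < B ω} := by
  have key : ∀ ω, ENNReal.ofReal (A ω + R) * ENNReal.ofReal (B ω + R) =
      ∫⁻ q, {q : (ℝ × ℝ) × Ω | q.1.1 < A q.2 ∧ q.1.2 < B q.2}.indicator 1 (q, ω)
        ∂((volume.restrict (Ioi (-R))).prod (volume.restrict (Ioi (-R)))) := by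
    intro ω
    rw [ofReal_layer R (A ω), ofReal_layer R (B ω), ← lintegral_prod_mul]
    · refine lintegral_congr fun q => ?_
      by_cases h1 : q.1 < A ω <;> by_cases h2 : q.2 < B ω <;> simp [indicator, h1, h2]
    · exact (measurable_one.indicator measurableSet_Iio).aemeasurable
    · exact (measurable_one.indicator measurableSet_Iio).aemeasurable
  have hS : MeasurableSet {q : (ℝ × ℝ) × Ω | q.1.1 < A q.2 ∧ q.1.2 < B q.2} :=
    measurableSet_and_lt (by fun_prop) (by fun_prop) (by fun_prop) (by fun_prop)
  have hf : Measurable ({q : (ℝ × ℝ) × Ω | q.1.1 < A q.2 ∧ q.1.2 < B q.2}.indicator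
    (1 : (ℝ × ℝ) × Ω → ENNReal)) := measurable_one.indicator hS
  simp_rw [key]
  rw [lintegral_lintegral_swap]
  · have e : ∀ q : ℝ × ℝ, ∫⁻ ω, {q : (ℝ × ℝ) × Ω | q.1.1 < A q.2 ∧ q.1.2 < B q.2}.indicator 1 (q, ω) ∂P
      = P {ω | q.1 < A ω ∧ q.2 < B ω} := by
      intro q
      have : MeasurableSet {ω | q.1 < A ω ∧ q.2 < B ω} := measurable_prodMk_left (x := q) hS
      rw [← lintegral_indicator_one this]
      rfl
    simp_rw [e]
    rw [lintegral_prod]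
    exact (measurable_measure_prodMk_left hS).aemeasurable
  · exact (hf.comp measurable_swap).aemeasurable

lemma integrable_of_bdd {Ω : Type*} [MeasurableSpace Ω] (P : Measure Ω) [IsProbabilityMeasure P]
    (R : ℝ) (A : Ω → ℝ) (hA : Measurable A) (hAb : ∀ᵐ ω ∂P, |A ω| ≤ R) : Integrable A P :=
  Integrable.of_bound hA.aestronglyMeasurable R hAb

lemma layer_int {O : Type*} [MeasurableSpace O] (Q : Measure O) [IsProbabilityMeasure Q] (R : ℝ)
    (a b : O → ℝ) (ha : Measurable a) (hb : Measurable b) (ba : ∀ᵐ ω ∂Q, |a ω| ≤ R)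
    (bb : ∀ᵐ ω ∂Q, |b ω| ≤ R) :
    Integrable (fun ω => a ω * b ω) Q ∧
      ENNReal.ofReal (∫ ω, a ω * b ω ∂Q + R * ∫ ω, a ω ∂Q + R * ∫ ω, b ω ∂Q + R * R) =
      ∫⁻ s in Ioi (-R), ∫⁻ t in Ioi (-R), Q {ω | s < a ω ∧ t < b ω} ∧
      0 ≤ ∫ ω, a ω * b ω ∂Q + R * ∫ ω, a ω ∂Q + R * ∫ ω, b ω ∂Q + R * R := by
  have ia := integrable_of_bdd Q R a ha ba
  have ib := integrable_of_bdd Q R b hb bb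
  have iab : Integrable (fun ω => a ω * b ω) Q := by
    refine integrable_of_bdd Q (R * R) _ (ha.mul hb) ?_
    filter_upwards [ba, bb] with ω h1 h2
    rw [abs_mul]
    exact mul_le_mul h1 h2 (abs_nonneg _) ((abs_nonneg _).trans h1)
  have e : ∫ ω, (a ω + R) * (b ω + R) ∂Q =
      ∫ ω, a ω * b ω ∂Q + R * ∫ ω, a ω ∂Q + R * ∫ ω, b ω ∂Q + R * R := by
    have : ∀ ω, (a ω + R) * (b ω + R) = a ω * b ω + R * a ω + R * b ω + R * R := by
      intro ω; ring
    simp_rw [this]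
    rw [integral_add, integral_add, integral_add, integral_const_mul, integral_const_mul]
    · simp
    · exact iab
    · exact ia.const_mul R
    · exact iab.add (ia.const_mul R)
    · exact ib.const_mul R
    · exact (iab.add (ia.const_mul R)).add (ib.const_mul R)
    · exact integrable_const _
  have nn : 0 ≤ᵐ[Q] fun ω => (a ω + R) * (b ω + R) := by
    filter_upwards [ba, bb] with ω h1 h2
    have := (abs_le.1 h1).1
    have := (abs_le.1 h2).1
    exact mul_nonneg (by linarith) (by linarith)
  refine ⟨iab, ?_, ?_⟩
  · rw [← layer2 Q R a b ha hb, ← e, ofReal_integral_eq_lintegral_ofReal]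
    · refine lintegral_congr_ae ?_
      filter_upwards [ba] with ω h1
      have := (abs_le.1 h1).1
      exact ENNReal.ofReal_mul (by linarith)
    · have : (fun ω => (a ω + R) * (b ω + R)) =
        fun ω => a ω * b ω + R * a ω + R * b ω + R * R := by
        ext ω; ring
      rw [this]
      exact ((iab.add (ia.const_mul R)).add (ib.const_mul R)).add (integrable_const _)
    · exact nn
  · rw [← e]
    exact integral_nonneg_of_ae nn

lemma compare {Ω Ω' : Type*} [MeasurableSpace Ω] [MeasurableSpace Ω']
    (P : Measure Ω) [IsProbabilityMeasure P] (P' : Measure Ω') [IsProbabilityMeasure P'] (R : ℝ)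
    (A B : Ω → ℝ) (A' B' : Ω' → ℝ) (hA : Measurable A) (hB : Measurable B)
    (hA' : Measurable A') (hB' : Measurable B')
    (bA : ∀ᵐ ω ∂P, |A ω| ≤ R) (bB : ∀ᵐ ω ∂P, |B ω| ≤ R)
    (bA' : ∀ᵐ ω ∂P', |A' ω| ≤ R) (bB' : ∀ᵐ ω ∂P', |B' ω| ≤ R)
    (iA : ∫ ω, A ω ∂P = ∫ ω, A' ω ∂P') (iB : ∫ ω, B ω ∂P = ∫ ω, B' ω ∂P')
    (h : ∀ s t, P {ω | s < A ω ∧ t < B ω} ≤ P' {ω | s < A' ω ∧ t < B' ω}) :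
    ∫ ω, A ω * B ω ∂P ≤ ∫ ω, A' ω * B' ω ∂P' := by
  obtain ⟨-, g1, -⟩ := layer_int P R A B hA hB bA bB
  obtain ⟨-, g2, n2⟩ := layer_int P' R A' B' hA' hB' bA' bB'
  have : ENNReal.ofReal (∫ ω, A ω * B ω ∂P + R * ∫ ω, A ω ∂P + R * ∫ ω, B ω ∂P + R * R) ≤
    ENNReal.ofReal (∫ ω, A' ω * B' ω ∂P' + R * ∫ ω, A' ω ∂P' + R * ∫ ω, B' ω ∂P' + R * R) := by
    rw [g1, g2]
    exact lintegral_mono fun s => lintegral_mono fun t => h s t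
  rw [ENNReal.ofReal_le_ofReal_iff n2, iA, iB] at this
  linarith

lemma glue {Ω Z B : Type*} [MeasurableSpace Ω] [MeasurableSpace Z] [MeasurableSpace B]
    [StandardBorelSpace B] [Nonempty B] (P : Measure Ω) [IsProbabilityMeasure P] (z : Ω → Z)
    (hz : Measurable z) (ρ : Measure (Z × B)) [IsProbabilityMeasure ρ] (h : P.map z = ρ.fst) :
    ∃ Q : Measure (Ω × B), IsProbabilityMeasure Q ∧ Q.map Prod.fst = P ∧
      Q.map (fun p => (z p.1, p.2)) = ρ := by
  refine ⟨P ⊗ₘ (ρ.condKernel.comap z hz), inferInstance, ?_, ?_⟩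
  · exact Measure.fst_compProd P _
  · conv_rhs => rw [← ρ.disintegrate ρ.condKernel, ← h]
    have hm : Measurable (fun p : Ω × B => (z p.1, p.2)) := by fun_prop
    ext s hs
    rw [Measure.map_apply hm hs, Measure.compProd_apply (hm hs), Measure.compProd_apply hs,
      lintegral_map (Kernel.measurable_kernel_prodMk_left hs) hz]
    rfl

lemma law_snd {Ω : Type*} [MeasurableSpace Ω] (P : Measure Ω) (μ : Measure X)
    [IsProbabilityMeasure μ] (κ : Kernel X ℝ) [IsMarkovKernel κ] (x : Ω → X) (A : Ω → ℝ)
    (hx : Measurable x) (hA : Measurable A) (h1 : P.map (fun ω => (x ω, A ω)) = μ ⊗ₘ κ) :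
    P.map A = (μ.prod unifM).map (qfun κ) := by
  have e := congrArg (fun m => m.map Prod.snd) (h1.trans (map_qfun μ κ).symm)
  rw [Measure.map_map measurable_snd (hx.prodMk hA),
    Measure.map_map measurable_snd (measurable_fst.prodMk (measurable_qfun κ))] at e
  exact e

lemma ae_bdd_of_map_eq {Ω Ω' : Type*} [MeasurableSpace Ω] [MeasurableSpace Ω'] {P : Measure Ω}
    {P' : Measure Ω'} {A : Ω → ℝ} {A' : Ω' → ℝ} (hA : Measurable A) (hA' : Measurable A')
    (h : P.map A = P'.map A') {R : ℝ} (b : ∀ᵐ ω ∂P, |A ω| ≤ R) : ∀ᵐ ω ∂P', |A' ω| ≤ R := by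
  have hs : MeasurableSet {a : ℝ | |a| ≤ R} := measurableSet_le (by fun_prop) measurable_const
  have : ∀ᵐ a ∂(P.map A), |a| ≤ R := (ae_map_iff hA.aemeasurable hs).2 b
  rw [h] at this
  exact (ae_map_iff hA'.aemeasurable hs).1 this

lemma integral_of_map_eq {Ω Ω' : Type*} [MeasurableSpace Ω] [MeasurableSpace Ω'] {P : Measure Ω}
    {P' : Measure Ω'} {A : Ω → ℝ} {A' : Ω' → ℝ} (hA : Measurable A) (hA' : Measurable A')
    (h : P.map A = P'.map A') : ∫ ω, A ω ∂P = ∫ ω, A' ω ∂P' := by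
  have e1 : ∫ a, a ∂(P.map A) = ∫ ω, A ω ∂P :=
    integral_map hA.aemeasurable measurable_id.aestronglyMeasurable
  have e2 : ∫ a, a ∂(P'.map A') = ∫ ω, A' ω ∂P' :=
    integral_map hA'.aemeasurable measurable_id.aestronglyMeasurable
  rw [← e1, ← e2, h]

/-- Upper bound for the product moment of any coupling, and integrability of the bound. -/
lemma upper_abs {Ω : Type*} [MeasurableSpace Ω] (P : Measure Ω) [IsProbabilityMeasure P]
    (μ : Measure X) [IsProbabilityMeasure μ] (κ η : Kernel X ℝ) [IsMarkovKernel κ]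
    [IsMarkovKernel η] (x : Ω → X) (A B : Ω → ℝ) (hx : Measurable x) (hA : Measurable A)
    (hB : Measurable B) (h1 : P.map (fun ω => (x ω, A ω)) = μ ⊗ₘ κ)
    (h2 : P.map (fun ω => (x ω, B ω)) = μ ⊗ₘ η) {R : ℝ}
    (bA : ∀ᵐ ω ∂P, |A ω| ≤ R) (bB : ∀ᵐ ω ∂P, |B ω| ≤ R) :
    ∫ ω, A ω * B ω ∂P ≤ ∫ p, qfun κ p * qfun η p ∂(μ.prod unifM) ∧
      Integrable (fun p => qfun κ p * qfun η p) (μ.prod unifM) := by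
  have l1 := law_snd P μ κ x A hx hA h1
  have l2 := law_snd P μ η x B hx hB h2
  have b1 := ae_bdd_of_map_eq hA (measurable_qfun κ) l1 bA
  have b2 := ae_bdd_of_map_eq hB (measurable_qfun η) l2 bB
  refine ⟨compare P (μ.prod unifM) R A B (qfun κ) (qfun η) hA hB (measurable_qfun κ)
    (measurable_qfun η) bA bB b1 b2 (integral_of_map_eq hA (measurable_qfun κ) l1)
    (integral_of_map_eq hB (measurable_qfun η) l2) fun s t => ?_,
    (layer_int _ R _ _ (measurable_qfun κ) (measurable_qfun η) b1 b2).1⟩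
  rw [prod_tail]
  exact coupling_tail P μ κ η x A B hx hA hB h1 h2 s t

lemma attain_abs {B : Type*} [MeasurableSpace B] [StandardBorelSpace B] [Nonempty B]
    (μ : Measure X) [IsProbabilityMeasure μ] (κ1 : Kernel X ℝ) [IsMarkovKernel κ1]
    (κ0 : Kernel X B) [IsMarkovKernel κ0] (g : B → ℝ) (hg : Measurable g) :
    ∃ Q : Measure (ℝ × B × X), IsProbabilityMeasure Q ∧
      Q.map (fun p => (p.2.2, p.1)) = μ ⊗ₘ κ1 ∧ Q.map (fun p => (p.2.2, p.2.1)) = μ ⊗ₘ κ0 ∧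
      ∫ p, p.1 * g p.2.1 ∂Q = ∫ p, qfun κ1 p * qfun (κ0.map g) p ∂(μ.prod unifM) := by
  have : IsMarkovKernel (κ0.map g) := Kernel.IsMarkovKernel.map κ0 hg
  have hq1 := measurable_qfun κ1
  have hq0 := measurable_qfun (κ0.map g)
  have hr : Measurable (fun q : X × B => ((q.1, g q.2), q.2)) := by fun_prop
  have hz : Measurable (fun p : X × ℝ => (p.1, qfun (κ0.map g) p)) := measurable_fst.prodMk hq0
  have : IsProbabilityMeasure ((μ ⊗ₘ κ0).map (fun q : X × B => ((q.1, g q.2), q.2))) :=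
    Measure.isProbabilityMeasure_map hr.aemeasurable
  obtain ⟨Q, hQ, hQ1, hQ2⟩ := glue (μ.prod unifM) (fun p : X × ℝ => (p.1, qfun (κ0.map g) p)) hz
    ((μ ⊗ₘ κ0).map (fun q : X × B => ((q.1, g q.2), q.2))) (by
      rw [map_qfun, Measure.compProd_map hg, Measure.fst, Measure.map_map measurable_fst hr]
      rfl)
  have hm : Measurable (fun ω : (X × ℝ) × B => (qfun κ1 ω.1, ω.2, ω.1.1)) := by fun_prop
  refine ⟨Q.map (fun ω => (qfun κ1 ω.1, ω.2, ω.1.1)), Measure.isProbabilityMeasure_map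
    hm.aemeasurable, ?_, ?_, ?_⟩
  · rw [Measure.map_map (by fun_prop) hm, ← map_qfun μ κ1, ← hQ1,
      Measure.map_map (by fun_prop) measurable_fst]
    rfl
  · rw [Measure.map_map (by fun_prop) hm]
    have e := congrArg (fun m => m.map (fun r : (X × ℝ) × B => (r.1.1, r.2))) hQ2
    rw [Measure.map_map (by fun_prop) (by fun_prop), Measure.map_map (by fun_prop) hr] at e
    refine e.trans ?_
    exact Measure.map_id
  · have hae : ∀ᵐ ω ∂Q, qfun (κ0.map g) ω.1 = g ω.2 := by
      have hs : MeasurableSet {r : (X × ℝ) × B | r.1.2 = g r.2} :=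
        measurableSet_eq_fun (by fun_prop) (by fun_prop)
      have : ∀ᵐ r ∂((μ ⊗ₘ κ0).map (fun q : X × B => ((q.1, g q.2), q.2))), r.1.2 = g r.2 :=
        (ae_map_iff hr.aemeasurable hs).2 (Filter.Eventually.of_forall fun _ => rfl)
      rw [← hQ2] at this
      exact (ae_map_iff (by fun_prop) hs).1 this
    rw [integral_map hm.aemeasurable (Measurable.aestronglyMeasurable (by fun_prop)), ← hQ1,
      integral_map measurable_fst.aemeasurable (Measurable.aestronglyMeasurable (by fun_prop))]
    refine integral_congr_ae ?_
    filter_upwards [hae] with ω h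
    simp only [h]

lemma integrable_cpt {S F : Type*} [TopologicalSpace S] [T2Space S] [SecondCountableTopology S]
    [MeasurableSpace S] [BorelSpace S]
    [NormedAddCommGroup F] (μ : Measure S) [IsFiniteMeasure μ] {K : Set S} (hK : IsCompact K)
    (h : μ Kᶜ = 0) (f : S → F) (hf : Continuous f) : Integrable f μ := by
  have := hf.continuousOn.integrableOn_compact (μ := μ) hK
  rwa [IntegrableOn, Measure.restrict_eq_self_of_ae_mem] at this
  exact h

lemma ae_bdd_cpt {S : Type*} [TopologicalSpace S]
    [MeasurableSpace S] (μ : Measure S) {K : Set S} (hK : IsCompact K)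
    (h : μ Kᶜ = 0) (f : S → ℝ) (hf : Continuous f) : ∃ R, ∀ᵐ s ∂μ, |f s| ≤ R := by
  obtain ⟨C, hC⟩ := hK.exists_bound_of_continuousOn hf.continuousOn
  refine ⟨C, ?_⟩
  have : ∀ᵐ s ∂μ, s ∈ K := h
  filter_upwards [this] with s hs using hC s hs

lemma MSet_cpt {E0 EX : Type*} [TopologicalSpace E0] [TopologicalSpace EX]
    [MeasurableSpace E0] [MeasurableSpace EX] 
    (μ1X : Measure (ℝ × EX)) (μ0X : Measure (E0 × EX))
    (hcpt1 : ∃ K, IsCompact K ∧ μ1X Kᶜ = 0)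
    (hcpt0 : ∃ K, IsCompact K ∧ μ0X Kᶜ = 0) :
    ∃ K : Set (ℝ × E0 × EX), IsCompact K ∧ ∀ μ ∈ MSet μ1X μ0X, μ Kᶜ = 0 := by
  obtain ⟨K1, hK1, h1⟩ := hcpt1
  obtain ⟨K0, hK0, h0⟩ := hcpt0
  refine ⟨(Prod.fst '' K1) ×ˢ ((Prod.fst '' K0) ×ˢ (Prod.snd '' K0)),
    (hK1.image continuous_fst).prod ((hK0.image continuous_fst).prod (hK0.image continuous_snd)),
    ?_⟩
  rintro μ ⟨-, e1, e0⟩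
  have a1 : ∀ᵐ p ∂μ, (p.1, p.2.2) ∈ K1 := by
    have : ∀ᵐ q ∂μ1X, q ∈ K1 := h1
    rw [← e1] at this
    exact ae_of_ae_map (by fun_prop) this
  have a0 : ∀ᵐ p ∂μ, (p.2.1, p.2.2) ∈ K0 := by
    have : ∀ᵐ q ∂μ0X, q ∈ K0 := h0
    rw [← e0] at this
    exact ae_of_ae_map (by fun_prop) this
  change ∀ᵐ p ∂μ, p ∈ (Prod.fst '' K1) ×ˢ ((Prod.fst '' K0) ×ˢ (Prod.snd '' K0))
  filter_upwards [a1, a0] with p h1 h0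
  exact ⟨⟨_, h1, rfl⟩, ⟨_, h0, rfl⟩, ⟨_, h0, rfl⟩⟩

section concrete

variable {d0 dx : ℕ}

lemma isCompact_MSet 
    (μ1X : Measure (ℝ × EuclideanSpace ℝ (Fin dx)))
    (μ0X : Measure (EuclideanSpace ℝ (Fin d0) × EuclideanSpace ℝ (Fin dx)))
    [IsProbabilityMeasure μ1X] [IsProbabilityMeasure μ0X]
    (hcpt1 : ∃ K, IsCompact K ∧ μ1X Kᶜ = 0)
    (hcpt0 : ∃ K, IsCompact K ∧ μ0X Kᶜ = 0) :
    IsCompact {μ : ProbabilityMeasure (ℝ × EuclideanSpace ℝ (Fin d0) × EuclideanSpace ℝ (Fin dx)) |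
      (μ : Measure _) ∈ MSet μ1X μ0X} := by
  set M := {μ : ProbabilityMeasure (ℝ × EuclideanSpace ℝ (Fin d0) × EuclideanSpace ℝ (Fin dx)) |
      (μ : Measure _) ∈ MSet μ1X μ0X} with hM
  obtain ⟨K, hK, hKM⟩ := MSet_cpt μ1X μ0X hcpt1 hcpt0
  have c1 : Continuous (fun p : ℝ × EuclideanSpace ℝ (Fin d0) × EuclideanSpace ℝ (Fin dx) =>
    (p.1, p.2.2)) := by fun_prop
  have c0 : Continuous (fun p : ℝ × EuclideanSpace ℝ (Fin d0) × EuclideanSpace ℝ (Fin dx) =>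
    (p.2.1, p.2.2)) := by fun_prop
  have hcl : IsClosed M := by
    have : M = (fun μ : ProbabilityMeasure _ => μ.map c1.aemeasurable) ⁻¹' {⟨μ1X, inferInstance⟩} ∩
      (fun μ : ProbabilityMeasure _ => μ.map c0.aemeasurable) ⁻¹' {⟨μ0X, inferInstance⟩} := by
      ext μ
      constructor
      · rintro ⟨-, h1, h0⟩
        exact ⟨Subtype.ext h1, Subtype.ext h0⟩
      · rintro ⟨h1, h0⟩
        exact ⟨inferInstance, congrArg Subtype.val h1, congrArg Subtype.val h0⟩
    rw [this]
    exact (isClosed_singleton.preimage (ProbabilityMeasure.continuous_map c1)).inter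
      (isClosed_singleton.preimage (ProbabilityMeasure.continuous_map c0))
  have ht : IsTightMeasureSet {((μ : ProbabilityMeasure _) : Measure (ℝ × EuclideanSpace ℝ (Fin d0) ×
      EuclideanSpace ℝ (Fin dx))) | μ ∈ M} := by
    rw [isTightMeasureSet_iff_exists_isCompact_measure_compl_le]
    intro ε _
    refine ⟨K, hK, ?_⟩
    rintro _ ⟨μ, hμ, rfl⟩
    rw [hKM _ hμ]
    exact zero_le
  have := isCompact_closure_of_isTightMeasureSet ht
  rwa [hcl.closure_eq] at this

noncomputable def clipR (R x : ℝ) : ℝ := max (-R) (min R x)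

lemma clipR_abs {R : ℝ} (hR : 0 ≤ R) (x : ℝ) : |clipR R x| ≤ R := by
  unfold clipR
  rw [abs_le]
  exact ⟨le_max_left _ _, max_le (by linarith) (min_le_left _ _)⟩

lemma clipR_eq {R x : ℝ} (h : |x| ≤ R) : clipR R x = x := by
  unfold clipR
  rw [abs_le] at h
  rw [min_eq_right h.2, max_eq_right h.1]

lemma continuous_clipR (R : ℝ) : Continuous (clipR R) := by unfold clipR; fun_prop

lemma isCompact_moment
    (μ1X : Measure (ℝ × EuclideanSpace ℝ (Fin dx)))
    (μ0X : Measure (EuclideanSpace ℝ (Fin d0) × EuclideanSpace ℝ (Fin dx)))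
    [IsProbabilityMeasure μ1X] [IsProbabilityMeasure μ0X]
    (hcpt1 : ∃ K, IsCompact K ∧ μ1X Kᶜ = 0)
    (hcpt0 : ∃ K, IsCompact K ∧ μ0X Kᶜ = 0) :
    IsCompact ((fun μ : Measure (ℝ × EuclideanSpace ℝ (Fin d0) × EuclideanSpace ℝ (Fin dx)) =>
      ∫ p, p.1 • p.2.1 ∂μ) '' MSet μ1X μ0X) := by
  have hM := isCompact_MSet μ1X μ0X hcpt1 hcpt0
  set M := {μ : ProbabilityMeasure (ℝ × EuclideanSpace ℝ (Fin d0) × EuclideanSpace ℝ (Fin dx)) |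
      (μ : Measure _) ∈ MSet μ1X μ0X} with hMdef
  obtain ⟨K, hK, hKM⟩ := MSet_cpt μ1X μ0X hcpt1 hcpt0
  have himg : ((fun μ : Measure (ℝ × EuclideanSpace ℝ (Fin d0) × EuclideanSpace ℝ (Fin dx)) =>
      ∫ p, p.1 • p.2.1 ∂μ) '' MSet μ1X μ0X) =
      (fun μ : ProbabilityMeasure (ℝ × EuclideanSpace ℝ (Fin d0) × EuclideanSpace ℝ (Fin dx)) =>
      ∫ p, p.1 • p.2.1 ∂(μ : Measure (ℝ × EuclideanSpace ℝ (Fin d0) × EuclideanSpace ℝ (Fin dx)))) '' M := by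
    ext v
    constructor
    · rintro ⟨μ, hμ, rfl⟩
      exact ⟨⟨μ, hμ.1⟩, hμ, rfl⟩
    · rintro ⟨μ, hμ, rfl⟩
      exact ⟨μ, hμ, rfl⟩
  rw [himg]
  refine hM.image_of_continuousOn ?_
  obtain ⟨C, hC⟩ := hK.exists_bound_of_continuousOn
    (f := fun p : ℝ × EuclideanSpace ℝ (Fin d0) × EuclideanSpace ℝ (Fin dx) => p) continuousOn_id
  set R := max C 0 with hR
  have hR0 : 0 ≤ R := le_max_right _ _
  let f : Fin d0 → BoundedContinuousFunction
      (ℝ × EuclideanSpace ℝ (Fin d0) × EuclideanSpace ℝ (Fin dx)) ℝ := fun i =>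
    BoundedContinuousFunction.ofNormedAddCommGroup (fun p => clipR R p.1 * clipR R (p.2.1 i))
      (((continuous_clipR R).comp continuous_fst).mul ((continuous_clipR R).comp (by fun_prop)))
      (R * R) (fun p => by
        rw [Real.norm_eq_abs, abs_mul]
        exact mul_le_mul (clipR_abs hR0 _) (clipR_abs hR0 _) (abs_nonneg _) hR0)
  have hΦ : Continuous (fun μ : ProbabilityMeasure (ℝ × EuclideanSpace ℝ (Fin d0) ×
      EuclideanSpace ℝ (Fin dx)) => (WithLp.toLp 2 (fun i => ∫ p, f i p ∂(μ : Measure _)) :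
        EuclideanSpace ℝ (Fin d0))) := by
    refine (PiLp.continuous_toLp 2 _).comp (continuous_pi fun i => ?_)
    exact ProbabilityMeasure.continuous_integral_boundedContinuousFunction (f i)
  refine hΦ.continuousOn.congr fun μ hμ => ?_
  have h_int : Integrable (fun p : ℝ × EuclideanSpace ℝ (Fin d0) × EuclideanSpace ℝ (Fin dx) =>
      p.1 • p.2.1) (μ : Measure _) := integrable_cpt _ hK (hKM _ hμ) _ (by fun_prop)
  ext i
  have := (EuclideanSpace.proj (𝕜 := ℝ) i).integral_comp_comm h_int
  refine this.symm.trans ?_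
  refine integral_congr_ae ?_
  have hae : ∀ᵐ p ∂(μ : Measure _), p ∈ K := hKM _ hμ
  filter_upwards [hae] with p hp
  have hn := (hC p hp).trans (le_max_left C 0)
  have n1 : |p.1| ≤ R := (norm_fst_le p).trans hn
  have n2 : |p.2.1 i| ≤ R :=
    (PiLp.norm_apply_le p.2.1 i).trans ((norm_fst_le p.2).trans ((norm_snd_le p).trans hn))
  change _ = clipR R p.1 * clipR R (p.2.1 i)
  rw [clipR_eq n1, clipR_eq n2]
  simp

lemma convex_moment
    (μ1X : Measure (ℝ × EuclideanSpace ℝ (Fin dx)))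
    (μ0X : Measure (EuclideanSpace ℝ (Fin d0) × EuclideanSpace ℝ (Fin dx)))
    (hcpt1 : ∃ K, IsCompact K ∧ μ1X Kᶜ = 0)
    (hcpt0 : ∃ K, IsCompact K ∧ μ0X Kᶜ = 0) :
    Convex ℝ ((fun μ : Measure (ℝ × EuclideanSpace ℝ (Fin d0) × EuclideanSpace ℝ (Fin dx)) =>
      ∫ p, p.1 • p.2.1 ∂μ) '' MSet μ1X μ0X) := by
  obtain ⟨K, hK, hKM⟩ := MSet_cpt μ1X μ0X hcpt1 hcpt0
  rintro _ ⟨μ, hμ, rfl⟩ _ ⟨ν, hν, rfl⟩ a b ha hb hab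
  have hsum : ENNReal.ofReal a + ENNReal.ofReal b = 1 := by
    rw [← ENNReal.ofReal_add ha hb, hab, ENNReal.ofReal_one]
  have := hμ.1
  have := hν.1
  have iμ : Integrable (fun p : ℝ × EuclideanSpace ℝ (Fin d0) × EuclideanSpace ℝ (Fin dx) =>
      p.1 • p.2.1) μ := integrable_cpt _ hK (hKM _ hμ) _ (by fun_prop)
  have iν : Integrable (fun p : ℝ × EuclideanSpace ℝ (Fin d0) × EuclideanSpace ℝ (Fin dx) =>
      p.1 • p.2.1) ν := integrable_cpt _ hK (hKM _ hν) _ (by fun_prop)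
  refine ⟨ENNReal.ofReal a • μ + ENNReal.ofReal b • ν, ⟨⟨?_⟩, ?_, ?_⟩, ?_⟩
  · simp [hsum]
  · rw [Measure.map_add _ _ (by fun_prop), Measure.map_smul, Measure.map_smul, hμ.2.1, hν.2.1,
      ← add_smul, hsum, one_smul]
  · rw [Measure.map_add _ _ (by fun_prop), Measure.map_smul, Measure.map_smul, hμ.2.2, hν.2.2,
      ← add_smul, hsum, one_smul]
  · simp only
    rw [integral_add_measure (iμ.smul_measure ENNReal.ofReal_ne_top)
      (iν.smul_measure ENNReal.ofReal_ne_top), integral_smul_measure, integral_smul_measure,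
      ENNReal.toReal_ofReal ha, ENNReal.toReal_ofReal hb]

end concrete

end helpers

/-- Proposition 4: the identified set of the linear projection model with outcome `Y1 ∈ ℝ`
and regressors `(Y0, X) ∈ ℝ^{d0} × ℝ^{dx}`.  The parameter `θ = (θ0, θX)` satisfies the moment
condition `∫ ((y0ᵀ,xᵀ)θ − y1)(y0,x) dμ = 0` for some `μ ∈ M(μ1X, μ0X)` iff for every
`t = (t0, tX)` on the unit sphere of `ℝ^{d0+dx}`,
`tᵀ M θ ≤ ∫∫₀¹ F⁻¹_{t0ᵀY0∣x}(u) F⁻¹_{Y1∣x}(u) du dμX + tXᵀ 𝔼[Y1 X]`. -/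
theorem linear_projection_identified_set
    {d0 dx : ℕ}
    (μ1X : Measure (ℝ × EuclideanSpace ℝ (Fin dx)))
    (μ0X : Measure (EuclideanSpace ℝ (Fin d0) × EuclideanSpace ℝ (Fin dx)))
    [IsProbabilityMeasure μ1X] [IsProbabilityMeasure μ0X]
    (hcpt1 : ∃ K, IsCompact K ∧ μ1X Kᶜ = 0)
    (hcpt0 : ∃ K, IsCompact K ∧ μ0X Kᶜ = 0)
    (μX : Measure (EuclideanSpace ℝ (Fin dx))) [IsProbabilityMeasure μX]
    (hμX1 : μ1X.map Prod.snd = μX) (hμX0 : μ0X.map Prod.snd = μX)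
    (κ1 : Kernel (EuclideanSpace ℝ (Fin dx)) ℝ) [IsMarkovKernel κ1]
    (κ0 : Kernel (EuclideanSpace ℝ (Fin dx)) (EuclideanSpace ℝ (Fin d0))) [IsMarkovKernel κ0]
    (hκ1 : (μX.compProd κ1).map Prod.swap = μ1X)
    (hκ0 : (μX.compProd κ0).map Prod.swap = μ0X)
    (θ0 : EuclideanSpace ℝ (Fin d0)) (θX : EuclideanSpace ℝ (Fin dx)) :
    (∃ μ ∈ MSet μ1X μ0X,
        (∫ p : ℝ × EuclideanSpace ℝ (Fin d0) × EuclideanSpace ℝ (Fin dx),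
            ((⟪p.2.1, θ0⟫ + ⟪p.2.2, θX⟫) - p.1) • p.2.1 ∂μ) = 0 ∧
        (∫ p : ℝ × EuclideanSpace ℝ (Fin d0) × EuclideanSpace ℝ (Fin dx),
            ((⟪p.2.1, θ0⟫ + ⟪p.2.2, θX⟫) - p.1) • p.2.2 ∂μ) = 0) ↔
      ∀ (t0 : EuclideanSpace ℝ (Fin d0)) (tX : EuclideanSpace ℝ (Fin dx)),
        ‖t0‖ ^ 2 + ‖tX‖ ^ 2 = 1 →
        (∫ q : EuclideanSpace ℝ (Fin d0) × EuclideanSpace ℝ (Fin dx),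
            (⟪t0, q.1⟫ + ⟪tX, q.2⟫) * (⟪q.1, θ0⟫ + ⟪q.2, θX⟫) ∂μ0X) ≤
          (∫ x, ∫ u in Set.Ioo (0:ℝ) 1,
              quantile ((κ0 x).map (fun y0 => ⟪t0, y0⟫)) u * quantile (κ1 x) u ∂volume ∂μX) +
            ⟪tX, ∫ q : ℝ × EuclideanSpace ℝ (Fin dx), q.1 • q.2 ∂μ1X⟫ := by
  obtain ⟨K, hK, hKM⟩ := MSet_cpt μ1X μ0X hcpt1 hcpt0
  -- the moment vectors
  set m0 : EuclideanSpace ℝ (Fin d0) := ∫ q : EuclideanSpace ℝ (Fin d0) × EuclideanSpace ℝ (Fin dx),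
    (⟪q.1, θ0⟫ + ⟪q.2, θX⟫) • q.1 ∂μ0X with hm0
  set mX : EuclideanSpace ℝ (Fin dx) := ∫ q : EuclideanSpace ℝ (Fin d0) × EuclideanSpace ℝ (Fin dx),
    (⟪q.1, θ0⟫ + ⟪q.2, θX⟫) • q.2 ∂μ0X with hmX
  set vX : EuclideanSpace ℝ (Fin dx) := ∫ q : ℝ × EuclideanSpace ℝ (Fin dx), q.1 • q.2 ∂μ1X with hvX
  -- moments under a coupling
  have I0 : ∀ μ ∈ MSet μ1X μ0X,
      (∫ p : ℝ × EuclideanSpace ℝ (Fin d0) × EuclideanSpace ℝ (Fin dx),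
        ((⟪p.2.1, θ0⟫ + ⟪p.2.2, θX⟫) - p.1) • p.2.1 ∂μ) = m0 - ∫ p, p.1 • p.2.1 ∂μ := by
    intro μ hμ
    have := hμ.1
    simp_rw [sub_smul]
    rw [integral_sub (integrable_cpt μ hK (hKM μ hμ) _ (by fun_prop))
      (integrable_cpt μ hK (hKM μ hμ) _ (by fun_prop)), hm0]
    conv_rhs => rw [← hμ.2.2]
    rw [integral_map (by fun_prop) (Continuous.aestronglyMeasurable (by fun_prop))]
  have IX : ∀ μ ∈ MSet μ1X μ0X,
      (∫ p : ℝ × EuclideanSpace ℝ (Fin d0) × EuclideanSpace ℝ (Fin dx),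
        ((⟪p.2.1, θ0⟫ + ⟪p.2.2, θX⟫) - p.1) • p.2.2 ∂μ) = mX - vX := by
    intro μ hμ
    have := hμ.1
    simp_rw [sub_smul]
    rw [integral_sub (integrable_cpt μ hK (hKM μ hμ) _ (by fun_prop))
      (integrable_cpt μ hK (hKM μ hμ) _ (by fun_prop)), hmX, hvX]
    have e1 : ∫ q : ℝ × EuclideanSpace ℝ (Fin dx), q.1 • q.2 ∂μ1X = ∫ p, p.1 • p.2.2 ∂μ := by
      conv_lhs => rw [← hμ.2.1]
      rw [integral_map (by fun_prop) (Continuous.aestronglyMeasurable (by fun_prop))]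
    have e2 : ∫ q : EuclideanSpace ℝ (Fin d0) × EuclideanSpace ℝ (Fin dx),
        (⟪q.1, θ0⟫ + ⟪q.2, θX⟫) • q.2 ∂μ0X =
        ∫ p, (⟪p.2.1, θ0⟫ + ⟪p.2.2, θX⟫) • p.2.2 ∂μ := by
      conv_lhs => rw [← hμ.2.2]
      rw [integral_map (by fun_prop) (Continuous.aestronglyMeasurable (by fun_prop))]
    rw [e1, e2]
  have IL : ∀ (t0 : EuclideanSpace ℝ (Fin d0)) (tX : EuclideanSpace ℝ (Fin dx)),
      (∫ q : EuclideanSpace ℝ (Fin d0) × EuclideanSpace ℝ (Fin dx),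
        (⟪t0, q.1⟫ + ⟪tX, q.2⟫) * (⟪q.1, θ0⟫ + ⟪q.2, θX⟫) ∂μ0X) = ⟪t0, m0⟫ + ⟪tX, mX⟫ := by
    intro t0 tX
    obtain ⟨K0, hK0, h0⟩ := hcpt0
    rw [hm0, hmX, ← integral_inner (integrable_cpt μ0X hK0 h0 _ (by fun_prop)),
      ← integral_inner (integrable_cpt μ0X hK0 h0 _ (by fun_prop)),
      ← integral_add (integrable_cpt μ0X hK0 h0 _ (by fun_prop))
        (integrable_cpt μ0X hK0 h0 _ (by fun_prop))]
    refine integral_congr_ae (Filter.Eventually.of_forall fun q => ?_)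
    simp only [inner_smul_right]
    ring
  have IM : ∀ μ ∈ MSet μ1X μ0X, ∀ t0 : EuclideanSpace ℝ (Fin d0),
      ⟪t0, ∫ p : ℝ × EuclideanSpace ℝ (Fin d0) × EuclideanSpace ℝ (Fin dx), p.1 • p.2.1 ∂μ⟫ =
      ∫ p, p.1 * ⟪t0, p.2.1⟫ ∂μ := by
    intro μ hμ t0
    have := hμ.1
    rw [← integral_inner (integrable_cpt μ hK (hKM μ hμ) _ (by fun_prop))]
    simp_rw [inner_smul_right]
  -- laws
  have mk : ∀ t0 : EuclideanSpace ℝ (Fin d0),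
      Measurable (fun y0 : EuclideanSpace ℝ (Fin d0) => ⟪t0, y0⟫) := fun t0 => by fun_prop
  have law1 : ∀ μ ∈ MSet μ1X μ0X, μ.map (fun p => (p.2.2, p.1)) = μX ⊗ₘ κ1 := by
    intro μ hμ
    have e : (μ1X.map Prod.swap) = μX ⊗ₘ κ1 := by
      rw [← hκ1, Measure.map_map measurable_swap measurable_swap]
      simp
    rw [← e, ← hμ.2.1, Measure.map_map measurable_swap (by fun_prop)]
    rfl
  have law0 : ∀ μ ∈ MSet μ1X μ0X, ∀ t0 : EuclideanSpace ℝ (Fin d0),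
      μ.map (fun p => (p.2.2, ⟪t0, p.2.1⟫)) = μX ⊗ₘ (κ0.map fun y0 => ⟪t0, y0⟫) := by
    intro μ hμ t0
    have e : (μ0X.map Prod.swap) = μX ⊗ₘ κ0 := by
      rw [← hκ0, Measure.map_map measurable_swap measurable_swap]
      simp
    have h2 := mk t0
    rw [Measure.compProd_map (mk t0), ← e, ← hμ.2.2, Measure.map_map measurable_swap (by fun_prop),
      Measure.map_map (by fun_prop) (by fun_prop)]
    rfl
  -- the comonotone coupling
  have att : ∀ t0 : EuclideanSpace ℝ (Fin d0), ∃ μ ∈ MSet μ1X μ0X,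
      ∫ p, p.1 * ⟪t0, p.2.1⟫ ∂μ =
        ∫ p, qfun κ1 p * qfun (κ0.map fun y0 => ⟪t0, y0⟫) p ∂(μX.prod unifM) := by
    intro t0
    obtain ⟨Q, hQ, h1, h0, he⟩ := attain_abs μX κ1 κ0 (fun y0 => ⟪t0, y0⟫) (mk t0)
    refine ⟨Q, ⟨hQ, ?_, ?_⟩, he⟩
    · rw [← hκ1, ← h1, Measure.map_map measurable_swap (by fun_prop)]
      rfl
    · rw [← hκ0, ← h0, Measure.map_map measurable_swap (by fun_prop)]
      rfl
  have upp : ∀ μ ∈ MSet μ1X μ0X, ∀ t0 : EuclideanSpace ℝ (Fin d0),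
      ∫ p, p.1 * ⟪t0, p.2.1⟫ ∂μ ≤
        ∫ p, qfun κ1 p * qfun (κ0.map fun y0 => ⟪t0, y0⟫) p ∂(μX.prod unifM) ∧
      Integrable (fun p => qfun κ1 p * qfun (κ0.map fun y0 => ⟪t0, y0⟫) p) (μX.prod unifM) := by
    intro μ hμ t0
    have := hμ.1
    have : IsMarkovKernel (κ0.map fun y0 : EuclideanSpace ℝ (Fin d0) => ⟪t0, y0⟫) :=
      Kernel.IsMarkovKernel.map κ0 (mk t0)
    obtain ⟨R1, hR1⟩ := ae_bdd_cpt μ hK (hKM μ hμ) (fun p => p.1) (by fun_prop)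
    obtain ⟨R0, hR0⟩ := ae_bdd_cpt μ hK (hKM μ hμ) (fun p => ⟪t0, p.2.1⟫) (by fun_prop)
    refine upper_abs μ μX κ1 (κ0.map fun y0 => ⟪t0, y0⟫) (fun p => p.2.2) (fun p => p.1)
      (fun p => ⟪t0, p.2.1⟫) (by fun_prop) (by fun_prop) (by fun_prop) (law1 μ hμ) (law0 μ hμ t0)
      (R := max R1 R0) ?_ ?_
    · filter_upwards [hR1] with p hp using hp.trans (le_max_left _ _)
    · filter_upwards [hR0] with p hp using hp.trans (le_max_right _ _)
  -- the quantile integral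
  have qint : ∀ t0 : EuclideanSpace ℝ (Fin d0),
      (∫ x, ∫ u in Set.Ioo (0:ℝ) 1,
        quantile ((κ0 x).map (fun y0 => ⟪t0, y0⟫)) u * quantile (κ1 x) u ∂volume ∂μX) =
      ∫ p, qfun κ1 p * qfun (κ0.map fun y0 => ⟪t0, y0⟫) p ∂(μX.prod unifM) := by
    intro t0
    obtain ⟨μ, hμ, -⟩ := att t0
    rw [integral_prod _ (upp μ hμ t0).2]
    refine integral_congr_ae (Filter.Eventually.of_forall fun x => ?_)
    refine setIntegral_congr_fun measurableSet_Ioo fun u hu => ?_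
    simp only [qfun, hu, if_true]
    rw [Kernel.map_apply _ (mk t0), mul_comm]
  simp_rw [IL, qint]
  constructor
  · rintro ⟨μ, hμ, h1, h2⟩ t0 tX -
    rw [I0 μ hμ, sub_eq_zero] at h1
    rw [IX μ hμ, sub_eq_zero] at h2
    rw [h2, h1, IM μ hμ t0]
    linarith [(upp μ hμ t0).1]
  · intro H
    -- the X-part
    have hX : mX - vX = 0 := by
      by_contra hne
      have hpos : 0 < ‖mX - vX‖ := norm_pos_iff.2 hne
      have h := H 0 (‖mX - vX‖⁻¹ • (mX - vX)) (by
        rw [norm_zero, norm_smul, norm_inv, norm_norm, inv_mul_cancel₀ hpos.ne']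
        norm_num)
      obtain ⟨μ, hμ, he⟩ := att 0
      rw [← he] at h
      simp only [inner_zero_left, zero_add, mul_zero, integral_zero] at h
      have h' : ⟪‖mX - vX‖⁻¹ • (mX - vX), mX - vX⟫ ≤ 0 := by
        rw [inner_sub_right]; linarith
      rw [real_inner_smul_left, real_inner_self_eq_norm_sq] at h'
      have : 0 < ‖mX - vX‖⁻¹ * ‖mX - vX‖ ^ 2 := by positivity
      linarith
    -- the Y0-part
    have hmem : m0 ∈ ((fun μ : Measure (ℝ × EuclideanSpace ℝ (Fin d0) × EuclideanSpace ℝ (Fin dx)) =>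
        ∫ p, p.1 • p.2.1 ∂μ) '' MSet μ1X μ0X) := by
      by_contra hnot
      obtain ⟨f, c, hf1, hf2⟩ := geometric_hahn_banach_closed_point
        (convex_moment μ1X μ0X hcpt1 hcpt0) (isCompact_moment μ1X μ0X hcpt1 hcpt0).isClosed hnot
      set t := (InnerProductSpace.toDual ℝ (EuclideanSpace ℝ (Fin d0))).symm f with ht
      have hft : ∀ v, f v = ⟪t, v⟫ := fun v => (InnerProductSpace.toDual_symm_apply).symm
      have ht0 : t ≠ 0 := by
        intro h0
        obtain ⟨μ, hμ, -⟩ := att 0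
        have a := hf1 _ ⟨μ, hμ, rfl⟩
        rw [hft, h0, inner_zero_left] at a
        rw [hft, h0, inner_zero_left] at hf2
        linarith
      have hpos : 0 < ‖t‖ := norm_pos_iff.2 ht0
      have h := H (‖t‖⁻¹ • t) 0 (by
        rw [norm_zero, norm_smul, norm_inv, norm_norm, inv_mul_cancel₀ hpos.ne']
        norm_num)
      obtain ⟨μ, hμ, he⟩ := att (‖t‖⁻¹ • t)
      rw [← he, ← IM μ hμ, inner_zero_left, inner_zero_left, add_zero, add_zero,
        real_inner_smul_left, real_inner_smul_left] at h
      have h3 := le_of_mul_le_mul_left h (inv_pos.2 hpos)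
      have a := hf1 _ ⟨μ, hμ, rfl⟩
      rw [hft] at a hf2
      simp only at a
      linarith
    obtain ⟨μ, hμ, he⟩ := hmem
    refine ⟨μ, hμ, ?_, ?_⟩
    · rw [I0 μ hμ, sub_eq_zero]
      exact he.symm
    · rw [IX μ hμ, hX]
end
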